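/- arXiv:2603.24395 — 5 statements merged into one kernel-verified Lean document; each statement's English description precedes it below -/
import Mathlib

section
/- Let α and β be real numbers with 0 < β < α. Then for every real x, α·sinh(x)² − β·sinh(x)·cosh(x) ≥ (√(α² − β²) − α)/2. -/
theorem stmt_0 (α β : ℝ) (hβ : 0 < β) (hβα : β < α) (x : ℝ) :
    α * Real.sinh x ^ 2 - β * (Real.sinh x * Real.cosh x) ≥
      (Real.sqrt (α ^ 2 - β ^ 2) - α) / 2 := by
  have hcs : Real.cosh x ^ 2 = Real.sinh x ^ 2 + 1 := Real.cosh_sq x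
  set s := Real.sinh x
  set c := Real.cosh x
  have hnonneg : 0 ≤ α * (c ^ 2 + s ^ 2) - β * (2 * s * c) := by
    have hαβ : 0 ≤ (α - β) * (c ^ 2 + s ^ 2) := mul_nonneg (by linarith) (by positivity)
    have hsq : 0 ≤ β * (c - s) ^ 2 := by positivity
    linarith
  have hsqrt : Real.sqrt (α ^ 2 - β ^ 2) ≤ α * (c ^ 2 + s ^ 2) - β * (2 * s * c) := by
    refine Real.sqrt_le_iff.2 ⟨hnonneg, ?_⟩
    have hone : (c ^ 2 - s ^ 2) ^ 2 = 1 := by rw [hcs]; ring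
    have hid : (α * (c ^ 2 + s ^ 2) - β * (2 * s * c)) ^ 2 =
        (α ^ 2 - β ^ 2) * (c ^ 2 - s ^ 2) ^ 2 +
          (α * (2 * s * c) - β * (c ^ 2 + s ^ 2)) ^ 2 := by ring
    rw [hid, hone, mul_one]
    exact le_add_of_nonneg_right (sq_nonneg _)
  rw [hcs] at hsqrt
  linarith
end

section
/- Let α and β be real numbers with 0 < β < α, and set x₀ = (1/2)·artanh(β/α). Then α·sinh(x₀)² − β·sinh(x₀)·cosh(x₀) = (√(α² − β²) − α)/2, and this value is strictly negative. -/
/-- The inverse hyperbolic tangent. -/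
noncomputable def artanh (y : ℝ) : ℝ := (1 / 2) * Real.log ((1 + y) / (1 - y))

theorem artanh_eq_real_artanh {y : ℝ} (hy : y ∈ Set.Ioo (-1) 1) : artanh y = Real.artanh y :=
  (Real.artanh_eq_half_log (Set.Ioo_subset_Icc_self hy)).symm

theorem mul_sinh_sq_sub_mul_sinh_mul_cosh (α β x : ℝ) :
    α * Real.sinh x ^ 2 - β * (Real.sinh x * Real.cosh x) =
      (α * Real.cosh (2 * x) - β * Real.sinh (2 * x) - α) / 2 := by
  rw [Real.cosh_two_mul, Real.sinh_two_mul, Real.cosh_sq]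
  ring

theorem stmt_1 (α β : ℝ) (hβ : 0 < β) (hβα : β < α) :
    α * Real.sinh ((1 / 2) * artanh (β / α)) ^ 2 -
        β * (Real.sinh ((1 / 2) * artanh (β / α)) * Real.cosh ((1 / 2) * artanh (β / α))) =
      (Real.sqrt (α ^ 2 - β ^ 2) - α) / 2 ∧
    (Real.sqrt (α ^ 2 - β ^ 2) - α) / 2 < 0 := by
  have hα : 0 < α := hβ.trans hβα
  have hd : 0 < α ^ 2 - β ^ 2 := by nlinarith
  have hy : β / α ∈ Set.Ioo (-1 : ℝ) 1 :=
    ⟨by linarith [div_pos hβ hα], (div_lt_one hα).2 hβα⟩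
  have hs : √(1 - (β / α) ^ 2) = √(α ^ 2 - β ^ 2) / α := by
    rw [show 1 - (β / α) ^ 2 = (α ^ 2 - β ^ 2) / α ^ 2 by field_simp,
      Real.sqrt_div hd.le, Real.sqrt_sq hα.le]
  have hS : 0 < √(α ^ 2 - β ^ 2) := Real.sqrt_pos.2 hd
  constructor
  · rw [mul_sinh_sq_sub_mul_sinh_mul_cosh, ← mul_assoc,
      show (2 : ℝ) * (1 / 2) = 1 by norm_num, one_mul, artanh_eq_real_artanh hy,
      Real.cosh_artanh hy, Real.sinh_artanh hy, hs]
    field_simp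
    linarith [Real.mul_self_sqrt hd.le]
  · have : √(α ^ 2 - β ^ 2) < α := (Real.sqrt_lt' hα).2 (by nlinarith)
    linarith
end

section
/- Let ħ > 0, κ > 0, and v ≥ 0. Set β = ħ·(3√π/4)^{2/3}·v·κ and α = ħ·κ·(4/(3√π))^{2/3} + β. Then |(1/2)·(√(α² − β²) − α) + (π/2)·(9/32)·ħ·κ·v²| ≤ (ħ·κ·v³/4)·(3√π/4)^{10/3}. -/
/-- The second-order Taylor expansion of `√(1 + 2x)` at `0`, with cubic remainder. -/
theorem abs_sqrt_one_add_two_mul_sub_le {x : ℝ} (hx : 0 ≤ x) :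
    |Real.sqrt (1 + 2 * x) - 1 - x + x ^ 2 / 2| ≤ x ^ 3 / 2 := by
  have hx3 : 0 ≤ x ^ 3 := by positivity
  have lower : 1 + x - x ^ 2 / 2 ≤ Real.sqrt (1 + 2 * x) := by
    rcases le_total x 4 with h | h
    · apply Real.le_sqrt_of_sq_le
      nlinarith [mul_nonneg hx3 (sub_nonneg.2 h)]
    · exact le_trans (by nlinarith) (Real.sqrt_nonneg _)
  have upper : Real.sqrt (1 + 2 * x) ≤ 1 + x - x ^ 2 / 2 + x ^ 3 / 2 := by
    apply Real.sqrt_le_iff.2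
    constructor
    · nlinarith [mul_nonneg hx (sq_nonneg (x - 1))]
    · nlinarith [mul_nonneg (sq_nonneg (x ^ 2)) (sq_nonneg (x - 1)), sq_nonneg (x ^ 2)]
  rw [abs_le]
  constructor <;> linarith

theorem stmt_3 (hbar κ v : ℝ) (hhbar : 0 < hbar) (hκ : 0 < κ) (hv : 0 ≤ v)
    (β α : ℝ)
    (hβ : β = hbar * (3 * Real.sqrt Real.pi / 4) ^ ((2 : ℝ) / 3) * v * κ)
    (hα : α = hbar * κ * (4 / (3 * Real.sqrt Real.pi)) ^ ((2 : ℝ) / 3) + β) :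
    |(1 / 2) * (Real.sqrt (α ^ 2 - β ^ 2) - α) + (Real.pi / 2) * (9 / 32) * hbar * κ * v ^ 2| ≤
      (hbar * κ * v ^ 3 / 4) * (3 * Real.sqrt Real.pi / 4) ^ ((10 : ℝ) / 3) := by
  have hb : 0 < 3 * Real.sqrt Real.pi / 4 := by positivity
  have hinv : (4 / (3 * Real.sqrt Real.pi)) ^ ((2 : ℝ) / 3)
      = ((3 * Real.sqrt Real.pi / 4) ^ ((2 : ℝ) / 3))⁻¹ := by
    rw [← Real.inv_rpow hb.le, inv_div]
  have hfifth : (3 * Real.sqrt Real.pi / 4) ^ ((10 : ℝ) / 3)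
      = ((3 * Real.sqrt Real.pi / 4) ^ ((2 : ℝ) / 3)) ^ 5 := by
    rw [← Real.rpow_mul_natCast hb.le]
    norm_num
  have hcube : ((3 * Real.sqrt Real.pi / 4) ^ ((2 : ℝ) / 3)) ^ 3 = 9 * Real.pi / 16 := by
    rw [← Real.rpow_mul_natCast hb.le]
    norm_num [div_pow, mul_pow, Real.sq_sqrt Real.pi_pos.le]
  have hc : 0 < (3 * Real.sqrt Real.pi / 4) ^ ((2 : ℝ) / 3) := Real.rpow_pos_of_pos hb _
  rw [hinv] at hα
  rw [hfifth]
  generalize (3 * Real.sqrt Real.pi / 4) ^ ((2 : ℝ) / 3) = c at *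
  have hA : 0 < hbar * κ / c := by positivity
  have hsqrt : Real.sqrt (α ^ 2 - β ^ 2)
      = hbar * κ / c * Real.sqrt (1 + 2 * (c ^ 2 * v)) := by
    rw [show α ^ 2 - β ^ 2 = (hbar * κ / c) ^ 2 * (1 + 2 * (c ^ 2 * v)) by
      rw [hα, hβ]; field_simp; ring, Real.sqrt_mul (sq_nonneg _), Real.sqrt_sq hA.le]
  have hpi : Real.pi = 16 / 9 * c ^ 3 := by linarith
  have hexp : (1 / 2) * (Real.sqrt (α ^ 2 - β ^ 2) - α)
        + (Real.pi / 2) * (9 / 32) * hbar * κ * v ^ 2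
      = hbar * κ / c / 2 *
        (Real.sqrt (1 + 2 * (c ^ 2 * v)) - 1 - c ^ 2 * v + (c ^ 2 * v) ^ 2 / 2) := by
    rw [hsqrt, hpi, hα, hβ]
    field_simp
    ring
  rw [hexp, abs_mul, abs_of_pos (half_pos hA)]
  calc _ ≤ hbar * κ / c / 2 * ((c ^ 2 * v) ^ 3 / 2) := by
        gcongr
        exact abs_sqrt_one_add_two_mul_sub_le (by positivity)
    _ = _ := by field_simp; ring
end

section
/- Let ħ > 0 and let v : ℤ³ → ℝ be nonnegative with Σ_{k ∈ ℤ³} v(k)²·‖k‖ < ∞, where ‖k‖ is the Euclidean norm. For k ∈ ℤ³ \ {0} set β_k = ħ·(3√π/4)^{2/3}·v(k)·‖k‖ and α_k = ħ·‖k‖·(4/(3√π))^{2/3} + β_k. Then the family k ↦ (1/2)·(α_k − √(α_k² − β_k²)) is summable over k ∈ ℤ³ \ {0}, each term is nonnegative, and Σ_{k ∈ ℤ³ \ {0}} (1/2)·(α_k − √(α_k² − β_k²)) ≤ (9π/32)·ħ·Σ_{k ∈ ℤ³ \ {0}} v(k)²·‖k‖. -/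
/-- Euclidean norm of a lattice point of `ℤ³`, viewed in `ℝ³`. -/
noncomputable def latNorm (k : Fin 3 → ℤ) : ℝ := Real.sqrt (∑ i, ((k i : ℝ)) ^ 2)

/-- The gap `a + b - √((a + b)² - b²)` is at most `b² / (2a)`. -/
theorem sub_sqrt_sq_sub_sq_le {a b : ℝ} (ha : 0 < a) (hb : 0 ≤ b) :
    a + b - Real.sqrt ((a + b) ^ 2 - b ^ 2) ≤ b ^ 2 / (2 * a) := by
  have hnonneg : 0 ≤ (a + b) ^ 2 - b ^ 2 := by nlinarith [mul_nonneg ha.le hb]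
  have hsq := Real.sq_sqrt hnonneg
  have hle : a ≤ Real.sqrt ((a + b) ^ 2 - b ^ 2) :=
    Real.le_sqrt_of_sq_le (by nlinarith [mul_nonneg ha.le hb])
  have hgap : Real.sqrt ((a + b) ^ 2 - b ^ 2) ≤ a + b :=
    Real.sqrt_le_iff.2 ⟨by positivity, by nlinarith [sq_nonneg b]⟩
  rw [le_div_iff₀ (by positivity)]
  nlinarith [mul_nonneg (sub_nonneg.2 hgap) (sub_nonneg.2 hle),
    mul_nonneg (sub_nonneg.2 hgap) hb]

theorem latNorm_pos {k : Fin 3 → ℤ} (hk : k ≠ 0) : 0 < latNorm k := by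
  obtain ⟨i, hi⟩ := Function.ne_iff.1 hk
  have hi' : (k i : ℝ) ≠ 0 := by exact_mod_cast hi
  exact Real.sqrt_pos.2 (Finset.sum_pos' (fun j _ => sq_nonneg _)
    ⟨i, Finset.mem_univ i, by positivity⟩)

theorem rpow_two_thirds_pow_three :
    ((3 * Real.sqrt Real.pi / 4) ^ ((2 : ℝ) / 3)) ^ 3 = 9 * Real.pi / 16 := by
  rw [← Real.rpow_natCast, ← Real.rpow_mul (by positivity)]
  norm_num
  rw [div_pow, mul_pow, Real.sq_sqrt Real.pi_pos.le]
  norm_num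

theorem stmt_5 (hbar : ℝ) (hhbar : 0 < hbar) (v : (Fin 3 → ℤ) → ℝ)
    (hv : ∀ k, 0 ≤ v k)
    (hsum : Summable fun k : Fin 3 → ℤ => v k ^ 2 * latNorm k)
    (β α : (Fin 3 → ℤ) → ℝ)
    (hβ : ∀ k, β k = hbar * (3 * Real.sqrt Real.pi / 4) ^ ((2 : ℝ) / 3) * v k * latNorm k)
    (hα : ∀ k, α k = hbar * latNorm k * (4 / (3 * Real.sqrt Real.pi)) ^ ((2 : ℝ) / 3) + β k) :
    Summable (fun k : {k : Fin 3 → ℤ // k ≠ 0} =>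
        (1 / 2) * (α k.1 - Real.sqrt (α k.1 ^ 2 - β k.1 ^ 2))) ∧
    (∀ k : {k : Fin 3 → ℤ // k ≠ 0},
        0 ≤ (1 / 2) * (α k.1 - Real.sqrt (α k.1 ^ 2 - β k.1 ^ 2))) ∧
    ∑' k : {k : Fin 3 → ℤ // k ≠ 0}, (1 / 2) * (α k.1 - Real.sqrt (α k.1 ^ 2 - β k.1 ^ 2)) ≤
      (9 * Real.pi / 32) * hbar * ∑' k : {k : Fin 3 → ℤ // k ≠ 0}, v k.1 ^ 2 * latNorm k.1 := by
  have hinv : (4 / (3 * Real.sqrt Real.pi)) ^ ((2 : ℝ) / 3) =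
      ((3 * Real.sqrt Real.pi / 4) ^ ((2 : ℝ) / 3))⁻¹ := by
    rw [← Real.inv_rpow (by positivity), inv_div]
  have hcube := rpow_two_thirds_pow_three
  have hc : 0 < (3 * Real.sqrt Real.pi / 4) ^ ((2 : ℝ) / 3) := by positivity
  rw [hinv] at hα
  generalize (3 * Real.sqrt Real.pi / 4) ^ ((2 : ℝ) / 3) = c at *
  have hnonneg : ∀ k : {k : Fin 3 → ℤ // k ≠ 0},
      0 ≤ (1 / 2) * (α k.1 - Real.sqrt (α k.1 ^ 2 - β k.1 ^ 2)) := by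
    intro k
    have hn := latNorm_pos k.2
    have hvk := hv k.1
    have hαk : 0 ≤ α k.1 := by rw [hα, hβ]; positivity
    have hle : Real.sqrt (α k.1 ^ 2 - β k.1 ^ 2) ≤ α k.1 :=
      Real.sqrt_le_iff.2 ⟨hαk, by nlinarith [sq_nonneg (β k.1)]⟩
    linarith
  have hbound : ∀ k : {k : Fin 3 → ℤ // k ≠ 0},
      (1 / 2) * (α k.1 - Real.sqrt (α k.1 ^ 2 - β k.1 ^ 2)) ≤
        (9 * Real.pi / 32) * hbar * (v k.1 ^ 2 * latNorm k.1) := by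
    intro k
    have hn := latNorm_pos k.2
    have hvk := hv k.1
    have hβk : 0 ≤ β k.1 := by rw [hβ]; positivity
    have hgap := sub_sqrt_sq_sub_sq_le (a := hbar * latNorm k.1 * c⁻¹) (by positivity) hβk
    rw [← hα] at hgap
    have heq : β k.1 ^ 2 / (2 * (hbar * latNorm k.1 * c⁻¹)) =
        c ^ 3 / 2 * hbar * (v k.1 ^ 2 * latNorm k.1) := by
      rw [hβ]
      field_simp
    rw [heq, hcube] at hgap
    have hpos : 0 ≤ Real.pi * hbar * (v k.1 ^ 2 * latNorm k.1) := by positivity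
    linarith
  have hsub : Summable fun k : {k : Fin 3 → ℤ // k ≠ 0} =>
      (9 * Real.pi / 32) * hbar * (v k.1 ^ 2 * latNorm k.1) :=
    (hsum.comp_injective Subtype.val_injective).mul_left _
  have hsummable := Summable.of_nonneg_of_le hnonneg hbound hsub
  refine ⟨hsummable, hnonneg, ?_⟩
  rw [← tsum_mul_left]
  exact hsummable.tsum_le_tsum hbound hsub
end

section
/- Let R > 0 and let k be a vector in Euclidean ℝ³ with ‖k‖ ≤ 2R. Then the Lebesgue volume of the set {x ∈ ℝ³ : ‖x‖ ≤ R and ‖x + k‖ > R} equals π·R²·‖k‖ − (π/12)·‖k‖³. -/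
open MeasureTheory

/-- The disc of squared radius `s` in coordinates. -/
lemma volume_setOf_sq_add_sq_le {s : ℝ} (hs : 0 ≤ s) :
    volume {y : Fin 2 → ℝ | y 0 ^ 2 + y 1 ^ 2 ≤ s} = ENNReal.ofReal (Real.pi * s) := by
  have hball : {y : Fin 2 → ℝ | y 0 ^ 2 + y 1 ^ 2 ≤ s} =
      WithLp.toLp 2 ⁻¹' Metric.closedBall (0 : EuclideanSpace ℝ (Fin 2)) √s := by
    ext y
    simp [EuclideanSpace.norm_eq, Fin.sum_univ_two, Real.sqrt_le_sqrt_iff hs]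
  rw [hball, (PiLp.volume_preserving_toLp (Fin 2)).measure_preimage
    measurableSet_closedBall.nullMeasurableSet, EuclideanSpace.volume_closedBall_fin_two,
    ← ENNReal.ofReal_pow (Real.sqrt_nonneg s), Real.sq_sqrt hs, mul_comm Real.pi,
    ENNReal.ofReal_mul hs]

/-- The part of a ball in `ℝ³` centred at the origin between two parallel planes at distance `h`
from the centre, orthogonal to the first coordinate axis. -/
lemma volume_slab_inter_closedBall {R h : ℝ} (h0 : 0 ≤ h) (hR : h ≤ R) :
    volume {x : EuclideanSpace ℝ (Fin 3) | x 0 ∈ Set.Ioc (-h) h ∧ ‖x‖ ≤ R} =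
      ENNReal.ofReal (Real.pi * (2 * R ^ 2 * h - 2 / 3 * h ^ 3)) := by
  set S : Set (ℝ × (Fin 2 → ℝ)) :=
    {p | p.1 ∈ Set.Ioc (-h) h ∧ p.1 ^ 2 + (p.2 0 ^ 2 + p.2 1 ^ 2) ≤ R ^ 2} with hS
  have hSm : MeasurableSet S := by
    rw [hS, Set.ofPred_and]
    refine (measurable_fst measurableSet_Ioc).inter (measurableSet_le ?_ measurable_const)
    fun_prop
  have hpre : {x : EuclideanSpace ℝ (Fin 3) | x 0 ∈ Set.Ioc (-h) h ∧ ‖x‖ ≤ R} =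
      (MeasurableEquiv.piFinSuccAbove (fun _ : Fin 3 => ℝ) 0 ∘ WithLp.ofLp) ⁻¹' S := by
    ext x
    simp [hS, EuclideanSpace.norm_eq, Fin.sum_univ_three, Real.sqrt_le_left (h0.trans hR),
      Fin.tail, add_assoc, MeasurableEquiv.piFinSuccAbove]
  have hsection (t : ℝ) : volume (Prod.mk t ⁻¹' S) =
      (Set.Ioc (-h) h).indicator (fun t => ENNReal.ofReal (Real.pi * (R ^ 2 - t ^ 2))) t := by
    by_cases ht : t ∈ Set.Ioc (-h) h
    · have hpos : 0 ≤ R ^ 2 - t ^ 2 := by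
        nlinarith [ht.1, ht.2]
      rw [Set.indicator_of_mem ht, ← volume_setOf_sq_add_sq_le hpos]
      congr 1
      ext y
      simp only [hS, Set.mem_preimage, Set.mem_ofPred_eq, ht, true_and]
      constructor <;> intro <;> linarith
    · rw [Set.indicator_of_notMem ht]
      convert measure_empty (μ := (volume : Measure (Fin 2 → ℝ)))
      exact Set.eq_empty_of_forall_notMem fun y hy => ht hy.1
  rw [hpre, ((volume_preserving_piFinSuccAbove (fun _ : Fin 3 => ℝ) 0).comp
    (PiLp.volume_preserving_ofLp (Fin 3))).measure_preimage hSm.nullMeasurableSet,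
    Measure.volume_eq_prod, Measure.prod_apply hSm]
  simp_rw [hsection]
  rw [lintegral_indicator measurableSet_Ioc, ← ofReal_integral_eq_lintegral_ofReal,
    ← intervalIntegral.integral_of_le (by linarith)]
  · congr 1
    rw [intervalIntegral.integral_const_mul, intervalIntegral.integral_sub (by simp) (by simp),
      intervalIntegral.integral_const, integral_pow, smul_eq_mul]
    ring
  · exact (Continuous.integrableOn_Icc (by fun_prop)).mono_set Set.Ioc_subset_Icc_self
  · filter_upwards [ae_restrict_mem measurableSet_Ioc] with t ht
    have : 0 ≤ R ^ 2 - t ^ 2 := by nlinarith [ht.1, ht.2]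
    exact mul_nonneg Real.pi_pos.le this

/-- The part of a ball in `ℝ³` centred at the origin between two parallel planes at distance `h`
from the centre. -/
lemma volume_inner_slab_inter_closedBall {R h : ℝ} (h0 : 0 ≤ h) (hR : h ≤ R)
    {u : EuclideanSpace ℝ (Fin 3)} (hu : ‖u‖ = 1) :
    volume {x : EuclideanSpace ℝ (Fin 3) | inner ℝ u x ∈ Set.Ioc (-h) h ∧ ‖x‖ ≤ R} =
      ENNReal.ofReal (Real.pi * (2 * R ^ 2 * h - 2 / 3 * h ^ 3)) := by
  have horth : Orthonormal ℝ (({0} : Set (Fin 3)).domRestrict fun _ => u) :=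
    ⟨fun _ => hu, fun i j hij => (hij (Subsingleton.elim i j)).elim⟩
  obtain ⟨b, hb⟩ := horth.exists_orthonormalBasis_extension_of_card_eq (by simp)
  have hb0 : b 0 = u := hb 0 rfl
  rw [← volume_slab_inter_closedBall h0 hR,
    ← b.measurePreserving_repr.measure_preimage (s := {x | x 0 ∈ Set.Ioc (-h) h ∧ ‖x‖ ≤ R})]
  · congr 1
    ext x
    simp [b.repr_apply_apply, hb0]
  · rw [Set.ofPred_and]
    refine MeasurableSet.nullMeasurableSet (MeasurableSet.inter ?_ ?_)
    · exact (show Measurable fun x : EuclideanSpace ℝ (Fin 3) => x 0 by fun_prop) measurableSet_Ioc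
    · exact measurableSet_le measurable_norm measurable_const

/-- Removing from a ball its translate by `-k` leaves the same volume as the slab of the ball
between the planes at distance `‖k‖ / 2` orthogonal to `k = ‖k‖ • u`. -/
lemma volume_closedBall_diff_translate {E : Type*} [NormedAddCommGroup E] [InnerProductSpace ℝ E]
    [MeasurableSpace E] [BorelSpace E] [FiniteDimensional ℝ E] (μ : Measure E)
    [μ.IsAddHaarMeasure] {R a : ℝ} (ha : 0 < a) {u : E} (hu : ‖u‖ = 1) :
    μ {x | ‖x‖ ≤ R ∧ R < ‖x + a • u‖} =
      μ {x | inner ℝ u x ∈ Set.Ioc (-(a / 2)) (a / 2) ∧ ‖x‖ ≤ R} := by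
  have hadd (x : E) : ‖x + a • u‖ ^ 2 = ‖x‖ ^ 2 + 2 * a * (inner ℝ u x + a / 2) := by
    rw [norm_add_sq_real, norm_smul, inner_smul_right, hu, real_inner_comm, Real.norm_eq_abs,
      mul_one, sq_abs]
    ring
  have hlt (x : E) : ‖x‖ < ‖x + a • u‖ ↔ -(a / 2) < inner ℝ u x := by
    rw [← pow_lt_pow_iff_left₀ (norm_nonneg _) (norm_nonneg _) two_ne_zero, hadd,
      lt_add_iff_pos_right, mul_pos_iff_of_pos_left (by positivity)]
    constructor <;> intro <;> linarith
  have hmeas (c : ℝ) : MeasurableSet {x : E | c < inner ℝ u x ∧ ‖x‖ ≤ R} := by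
    rw [Set.ofPred_and]
    exact (measurableSet_lt measurable_const (by fun_prop)).inter
      (measurableSet_le measurable_norm measurable_const)
  have hfin (c : ℝ) : μ {x : E | c < inner ℝ u x ∧ ‖x‖ ≤ R} ≠ ⊤ :=
    measure_ne_top_of_subset (fun x hx => mem_closedBall_zero_iff.2 hx.2)
      (measure_closedBall_lt_top (x := (0 : E)) (r := R)).ne
  set cap : ℝ → Set E := fun c => {x | c < inner ℝ u x ∧ ‖x‖ ≤ R} with hcap
  have hinner (x : E) : inner ℝ u (x + a • u) = inner ℝ u x + a := by
    rw [inner_add_right, inner_smul_right, real_inner_self_eq_norm_sq, hu]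
    ring
  have hshift : μ ((· + a • u) ⁻¹' cap (a / 2)) = μ (cap (a / 2)) :=
    measure_preimage_add_right μ _ _
  have hdiff : {x : E | ‖x‖ ≤ R ∧ R < ‖x + a • u‖} =
      cap (-(a / 2)) \ ((· + a • u) ⁻¹' cap (a / 2)) := by
    ext x
    have := hlt x
    have := hinner x
    simp only [hcap, Set.mem_ofPred_eq, Set.mem_sdiff, Set.mem_preimage]
    grind
  have hslab : {x : E | inner ℝ u x ∈ Set.Ioc (-(a / 2)) (a / 2) ∧ ‖x‖ ≤ R} =
      cap (-(a / 2)) \ cap (a / 2) := by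
    ext x
    simp only [hcap, Set.mem_ofPred_eq, Set.mem_sdiff, Set.mem_Ioc]
    grind
  rw [hdiff, hslab, measure_sdiff _ ((hmeas _).preimage (measurable_add_const _)).nullMeasurableSet
    (hshift ▸ hfin _), measure_sdiff _ (hmeas _).nullMeasurableSet (hfin _), hshift]
  · exact fun x hx => ⟨by linarith [hx.1], hx.2⟩
  · rintro x ⟨hx, hxR⟩
    have hx' : -(a / 2) < inner ℝ u x := by
      rw [hinner] at hx
      linarith
    exact ⟨hx', ((hlt x).2 hx').le.trans hxR⟩

theorem stmt_8 (R : ℝ) (hR : 0 < R) (k : EuclideanSpace ℝ (Fin 3)) (hk : ‖k‖ ≤ 2 * R) :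
    volume {x : EuclideanSpace ℝ (Fin 3) | ‖x‖ ≤ R ∧ R < ‖x + k‖} =
      ENNReal.ofReal (Real.pi * R ^ 2 * ‖k‖ - (Real.pi / 12) * ‖k‖ ^ 3) := by
  rcases eq_or_ne k 0 with rfl | hk0
  · have hempty : {x : EuclideanSpace ℝ (Fin 3) | ‖x‖ ≤ R ∧ R < ‖x + 0‖} = ∅ := by
      ext x
      simp
    rw [hempty]
    simp
  · have hpos : 0 < ‖k‖ := norm_pos_iff.2 hk0
    have hu : ‖‖k‖⁻¹ • k‖ = 1 := norm_smul_inv_norm (𝕜 := ℝ) hk0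
    have hdiff := volume_closedBall_diff_translate volume (R := R) hpos hu
    rw [smul_inv_smul₀ hpos.ne'] at hdiff
    rw [hdiff, volume_inner_slab_inter_closedBall (by positivity) (by linarith) hu]
    congr 1
    ring
end
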